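/- arXiv:2402.08131 — 2 statements merged into one kernel-verified Lean document; each statement's English description precedes it below -/
import Mathlib

section
/- Let G be a finite group, K = x^G a conjugacy class, and n ∈ ℕ with n ≥ 2. Then K^n is a conjugacy class if and only if χ(x)^n = χ(1)^{n-1} χ(x^n) for all irreducible characters χ of G. -/
open Pointwise CategoryTheory

/-- The conjugacy class of `a` in `G`. -/
def conjClass (G : Type*) [Group G] (a : G) : Set G := {b | IsConj a b}

/-- Number of ways of writing `h` as a product of `m` conjugates of `x`. -/
noncomputable def cnt {G : Type} [Group G] [Fintype G] (x : G) : ℕ → G → ℕ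
  | 0 => fun h => by classical exact if h = 1 then 1 else 0
  | m + 1 => fun h => ∑ g : G, cnt x m (h * (g * x * g⁻¹)⁻¹)

theorem cnt_ne_zero {G : Type} [Group G] [Fintype G] (x : G) (m : ℕ) (h : G) :
    cnt x m h ≠ 0 ↔ h ∈ (conjClass G x) ^ m := by
  induction m generalizing h with
  | zero => simp [cnt]
  | succ m ih =>
    simp only [cnt, ne_eq, Finset.sum_eq_zero_iff, Finset.mem_univ, true_imp_iff, not_forall]
    rw [pow_succ, Set.mem_mul]
    constructor
    · rintro ⟨g, hg⟩
      exact ⟨_, (ih _).1 hg, g * x * g⁻¹, isConj_iff.2 ⟨g, rfl⟩, by group⟩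
    · rintro ⟨a, ha, b, hb, rfl⟩
      obtain ⟨g, rfl⟩ := isConj_iff.1 hb
      exact ⟨g, (ih _).2 (by rwa [mul_inv_cancel_right])⟩

theorem cnt_sum {G : Type} [Group G] [Fintype G] (x : G) {A : Type*} [Semiring A]
    (f : G →* A) (m : ℕ) :
    (∑ g : G, f (g * x * g⁻¹)) ^ m = ∑ h : G, (cnt x m h : A) * f h := by
  induction m with
  | zero =>
    classical
    rw [pow_zero, Finset.sum_eq_single 1]
    · simp [cnt]
    · intro b _ hb
      simp [cnt, hb]
    · simp
  | succ m ih =>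
    rw [pow_succ, ih]
    simp only [cnt, Nat.cast_sum, Finset.sum_mul, Finset.mul_sum]
    conv_rhs => rw [Finset.sum_comm]
    refine Finset.sum_congr rfl fun g _ => ?_
    refine Fintype.sum_equiv (Equiv.mulRight (g * x * g⁻¹)) _ _ fun h => ?_
    rw [Equiv.coe_mulRight, mul_inv_cancel_right, map_mul f h, mul_assoc]

theorem cnt_total {G : Type} [Group G] [Fintype G] (x : G) (m : ℕ) :
    ∑ h : G, cnt x m h = Fintype.card G ^ m := by
  have := cnt_sum x (1 : G →* ℕ) m
  simpa using this.symm

theorem char_one_ne {G : Type} [Group G] [Fintype G] (V : FDRep ℂ G) (hV : Simple V) :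
    V.character 1 ≠ 0 := by
  intro h
  have h1 := (FDRep.simple_iff_char_is_norm_one V).1 hV
  rw [FDRep.char_one, Nat.cast_eq_zero] at h
  have : Subsingleton V := Module.finrank_zero_iff.1 h
  have h0 : ∀ g, V.character g = 0 := fun g => by
    have : V.ρ g = 0 := Subsingleton.elim _ _
    rw [FDRep.character, this, map_zero]
  simp only [h0, mul_zero, Finset.sum_const_zero] at h1
  exact NeZero.ne (Nat.card G : ℂ) h1.symm

theorem sum_conj_scalar {G : Type} [Group G] [Fintype G] (V : FDRep ℂ G) (hV : Simple V) (y : G) :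
    ∑ g : G, V.ρ (g * y * g⁻¹) =
      (Fintype.card G * V.character y / V.character 1 : ℂ) • (1 : V →ₗ[ℂ] V) := by
  set S := ∑ g : G, V.ρ (g * y * g⁻¹) with hS
  have hcomm : ∀ k, S * V.ρ k = V.ρ k * S := by
    intro k
    rw [hS, Finset.sum_mul, Finset.mul_sum]
    refine (Fintype.sum_equiv (Equiv.mulLeft k) _ _ fun g => ?_).symm
    rw [← map_mul, ← map_mul]
    congr 1
    simp [mul_assoc]
  let F : V ⟶ V := ⟨InducedCategory.homMk (ModuleCat.ofHom S), fun g => by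
    ext1
    exact hcomm g⟩
  obtain ⟨c, hc⟩ := endomorphism_simple_eq_smul_id ℂ F
  have hSc : S = c • (1 : V →ₗ[ℂ] V) := by
    have := congrArg (fun t : V ⟶ V => t.hom.hom.hom) hc
    exact this.symm
  have ht : LinearMap.trace ℂ V S = Fintype.card G * V.character y := by
    rw [hS, map_sum]
    have : ∀ g, LinearMap.trace ℂ V (V.ρ (g * y * g⁻¹)) = V.character y := fun g =>
      FDRep.char_conj V y g
    simp only [this, Finset.sum_const, Finset.card_univ, nsmul_eq_mul]
  have h1 : LinearMap.trace ℂ V (1 : V →ₗ[ℂ] V) = V.character 1 := by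
    rw [FDRep.character, map_one V.ρ]
  have hc' : c * V.character 1 = Fintype.card G * V.character y := by
    rw [← ht, hSc, map_smul, h1, smul_eq_mul]
  rw [hSc, ← hc', mul_div_cancel_right₀ _ (char_one_ne V hV)]

theorem simple_of_irreducible {G : Type} [Group G] [Fintype G]
    (M : Type) [AddCommGroup M] [Module ℂ M] [Module.Finite ℂ M]
    (ρ : Representation ℂ G M) (hirr : Representation.IsIrreducible ρ) : Simple (FDRep.of ρ) := by
  rw [FDRep.simple_iff_char_is_norm_one]
  have := invertibleOfNonzero (NeZero.ne (Nat.card G : ℂ))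
  have h := Representation.char_orthonormal ρ ρ
  rw [if_pos ⟨Representation.Equiv.refl _⟩] at h
  rw [inv_mul_eq_one₀ (NeZero.ne _)] at h
  exact h.symm

theorem irreducible_of_smul {G : Type} [Group G]
    (M : Type) [AddCommGroup M] [Module ℂ M] [Module (MonoidAlgebra ℂ G) M]
    [IsSimpleModule (MonoidAlgebra ℂ G) M]
    (ρ : Representation ℂ G M)
    (hρ : ∀ r : MonoidAlgebra ℂ G, ∀ w : M, ρ.asAlgebraHom r w = r • w) :
    Representation.IsIrreducible ρ := by
  let e : ρ.asModule ≃ₗ[MonoidAlgebra ℂ G] M :=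
    { ρ.asModuleEquiv.toAddEquiv with
      map_smul' := fun r w => hρ r (ρ.asModuleEquiv w) }
  rw [Representation.irreducible_iff_isSimpleModule_asModule]
  exact IsSimpleModule.congr e

theorem exists_rep_smul {G : Type} [Group G]
    (M : Type) [AddCommGroup M] [Module ℂ M] [Module (MonoidAlgebra ℂ G) M]
    [IsScalarTower ℂ (MonoidAlgebra ℂ G) M] : ∃ ρ : Representation ℂ G M,
      ∀ r : MonoidAlgebra ℂ G, ∀ w : M, ρ.asAlgebraHom r w = r • w := by
  refine ⟨Representation.ofModule' M, fun r w => ?_⟩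
  have : (Representation.ofModule' M : Representation ℂ G M).asAlgebraHom =
      Algebra.lsmul ℂ ℂ M := by
    rw [Representation.asAlgebraHom_def]
    exact (MonoidAlgebra.lift ℂ (M →ₗ[ℂ] M) G).apply_symm_apply _
  rw [this]
  rfl

theorem asAlgebraHom_eq_zero {G : Type} [Group G] [Fintype G] (a : MonoidAlgebra ℂ G)
    (ha : ∀ V : FDRep ℂ G, Simple V → Representation.asAlgebraHom V.ρ a = 0)
    (M : Type) [AddCommGroup M] [Module ℂ M] [Module.Finite ℂ M] (ρ : Representation ℂ G M)
    (hirr : Representation.IsIrreducible ρ) : ρ.asAlgebraHom a = 0 := by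
  have h := ha (FDRep.of ρ) (simple_of_irreducible M ρ hirr)
  rw [FDRep.of_ρ'] at h
  exact h

theorem smul_eq_zero_of_simple {G : Type} [Group G] [Fintype G] (a : MonoidAlgebra ℂ G)
    (ha : ∀ V : FDRep ℂ G, Simple V → Representation.asAlgebraHom V.ρ a = 0)
    (M : Type) [AddCommGroup M] [Module ℂ M] [Module (MonoidAlgebra ℂ G) M]
    [IsScalarTower ℂ (MonoidAlgebra ℂ G) M] [IsSimpleModule (MonoidAlgebra ℂ G) M]
    (v : M) : a • v = 0 := by
  have hfin : Module.Finite ℂ M := Module.Finite.trans (MonoidAlgebra ℂ G) M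
  obtain ⟨ρ, hρ⟩ := exists_rep_smul (G := G) M
  rw [← hρ, asAlgebraHom_eq_zero a ha M ρ (irreducible_of_smul M ρ hρ), LinearMap.zero_apply]

theorem eq_zero_of_simple {G : Type} [Group G] [Fintype G] (a : MonoidAlgebra ℂ G)
    (ha : ∀ V : FDRep ℂ G, Simple V → Representation.asAlgebraHom V.ρ a = 0) : a = 0 := by
  have hj : a ∈ Ring.jacobson (MonoidAlgebra ℂ G) := by
    rw [Ring.jacobson, Module.jacobson, Submodule.mem_sInf]
    intro m hm
    have hs : IsSimpleModule (MonoidAlgebra ℂ G) (MonoidAlgebra ℂ G ⧸ m) :=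
      isSimpleModule_iff_isCoatom.2 hm
    have h1 := smul_eq_zero_of_simple a ha (MonoidAlgebra ℂ G ⧸ m) (Submodule.Quotient.mk 1)
    rw [← Submodule.Quotient.mk_smul, Submodule.Quotient.mk_eq_zero] at h1
    simpa using h1
  rwa [IsSemisimpleRing.jacobson_eq_bot] at hj

theorem stmt2 {G : Type} [Group G] [Fintype G] (x : G) (n : ℕ) (hn : 2 ≤ n) :
    (∃ d : G, (conjClass G x) ^ n = conjClass G d) ↔
      ∀ (V : FDRep ℂ G), Simple V →
        V.character x ^ n = V.character 1 ^ (n - 1) * V.character (x ^ n) := by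
  obtain ⟨m, rfl⟩ : ∃ m, n = m + 1 := ⟨n - 1, by omega⟩
  have hG : (Fintype.card G : ℂ) ≠ 0 := by simp
  simp only [Nat.add_sub_cancel]
  constructor
  · rintro ⟨d, hd⟩ V hV
    have h1 := char_one_ne V hV
    have hx : IsConj d (x ^ (m + 1)) := by
      have : x ^ (m + 1) ∈ conjClass G x ^ (m + 1) := Set.pow_mem_pow (IsConj.refl x)
      rwa [hd] at this
    have hsum := cnt_sum x V.ρ (m + 1)
    rw [sum_conj_scalar V hV, smul_pow, one_pow] at hsum
    have ht := congrArg (LinearMap.trace ℂ V) hsum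
    have e1 : LinearMap.trace ℂ V (1 : V →ₗ[ℂ] V) = V.character 1 := by
      rw [FDRep.character, map_one V.ρ]
    rw [map_smul, e1, map_sum] at ht
    have e2 : ∀ h : G, LinearMap.trace ℂ V ((cnt x (m + 1) h : V →ₗ[ℂ] V) * V.ρ h) =
        cnt x (m + 1) h * V.character (x ^ (m + 1)) := by
      intro h
      rw [← nsmul_eq_mul, map_nsmul, nsmul_eq_mul]
      by_cases hz : cnt x (m + 1) h = 0
      · simp [hz]
      · have hh := (cnt_ne_zero x _ h).1 hz
        rw [hd] at hh
        obtain ⟨g, rfl⟩ := isConj_iff.1 (hx.symm.trans hh)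
        congr 1
        exact FDRep.char_conj V _ g
    simp only [e2] at ht
    rw [← Finset.sum_mul, ← Nat.cast_sum, cnt_total, smul_eq_mul, div_pow, mul_pow] at ht
    push_cast at ht
    have hGp := pow_ne_zero (m + 1) hG
    field_simp at ht
    have : V.character 1 * V.character x ^ (m + 1) =
        V.character 1 * (V.character 1 ^ m * V.character (x ^ (m + 1))) := by
      rw [← mul_assoc, ← pow_succ']
      linear_combination ht
    exact mul_left_cancel₀ h1 this
  · intro H
    have key : (∑ g : G, MonoidAlgebra.of ℂ G (g * x * g⁻¹)) ^ (m + 1) -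
        ((Fintype.card G : ℂ) ^ m) • ∑ g : G, MonoidAlgebra.of ℂ G (g * x ^ (m + 1) * g⁻¹) = 0 := by
      apply eq_zero_of_simple
      intro V hV
      have h1 := char_one_ne V hV
      rw [map_sub, map_pow, map_smul, map_sum, map_sum]
      simp only [Representation.asAlgebraHom_of]
      rw [sum_conj_scalar V hV, sum_conj_scalar V hV, smul_pow, one_pow, smul_smul, ← sub_smul]
      rw [div_pow, mul_pow, H V hV]
      convert zero_smul ℂ _
      field_simp
      ring
    rw [cnt_sum, sub_eq_zero] at key
    refine ⟨x ^ (m + 1), ?_⟩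
    ext h
    rw [← cnt_ne_zero]
    have e1 : ∀ g : G, (cnt x (m + 1) g : MonoidAlgebra ℂ G) * MonoidAlgebra.of ℂ G g =
        MonoidAlgebra.single g (cnt x (m + 1) g : ℂ) := fun g => by
      rw [← nsmul_eq_mul, MonoidAlgebra.of_apply, ← Nat.cast_smul_eq_nsmul ℂ]
      simp
    rw [Finset.sum_congr rfl fun g _ => e1 g] at key
    have hk := congrArg (fun a : MonoidAlgebra ℂ G => a.coeff h) key
    simp only [MonoidAlgebra.of_apply, MonoidAlgebra.coeff_sum, MonoidAlgebra.coeff_smul_apply,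
      MonoidAlgebra.coeff_single, Finsupp.finsetSum_apply] at hk
    classical
    simp only [Finsupp.single_apply, Finset.sum_ite_eq', Finset.mem_univ, if_true,
      Finset.sum_boole, smul_eq_mul] at hk
    have hk' : cnt x (m + 1) h =
        Fintype.card G ^ m * (Finset.univ.filter fun g : G => g * x ^ (m + 1) * g⁻¹ = h).card := by
      exact_mod_cast hk
    rw [hk']
    simp [Finset.filter_eq_empty_iff, conjClass, isConj_iff]
end

section
/- Let G be a finite group, N a normal subgroup, and x a p-element (for a prime p) such that all elements of the coset xN are conjugate in G. Then N has a normal p-complement. -/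
open Pointwise

open scoped IsMulCommutative in
theorem tate_aux {G U Q : Type*} [Group G] [Finite G] [Group U] [Finite U] [Group Q]
    {p : ℕ} [Fact p.Prime] (P : Subgroup G) (hPi : ¬ p ∣ P.index) (hU : IsPGroup p U)
    (π : P →* U) (ψ : U →* Q) (κ : G →* Q) (hc : ∀ y : P, ψ (π y) = κ y)
    (hZ : ψ.ker ≤ Subgroup.center U)
    (hK : κ.ker ≤ Subgroup.closure {k | k ∈ κ.ker ∧ ¬ p ∣ orderOf k}) :
    ∀ r : P, (r : G) ∈ κ.ker → r ∈ commutator P → π r = 1 := by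
  have hp : p.Prime := Fact.out
  intro r hr hr'
  let D : Subgroup (G × U) := (κ.comp (MonoidHom.fst G U)).eqLocus (ψ.comp (MonoidHom.snd G U))
  have hD : ∀ g u, (g, u) ∈ D ↔ κ g = ψ u := fun g u => Iff.rfl
  let f : D →* G := (MonoidHom.fst G U).comp D.subtype
  let T : Subgroup D := P.comap f
  have hTi : T.index.Coprime p := by
    rw [Nat.coprime_comm, hp.coprime_iff_not_dvd]
    intro hd
    apply hPi
    refine hd.trans ?_
    rw [Subgroup.index_comap]
    apply Subgroup.relIndex_dvd_index_of_le
    intro y hy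
    exact ⟨⟨(y, π ⟨y, hy⟩), (hD _ _).2 (hc ⟨y, hy⟩).symm⟩, rfl⟩
  have hφ : ∀ t : T, (π ⟨f t, t.2⟩)⁻¹ * t.1.1.2 ∈ ψ.ker := by
    rintro ⟨⟨⟨g, u⟩, hgu⟩, ht⟩
    have h1 := (hD _ _).1 hgu
    have ht' : g ∈ P := ht
    have h2 := hc ⟨g, ht'⟩
    rw [MonoidHom.mem_ker, map_mul, map_inv]
    change (ψ (π ⟨g, ht'⟩))⁻¹ * ψ u = 1
    rw [h2, ← h1]; simp
  let φ : T →* Subgroup.center U :=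
    { toFun := fun t => ⟨(π ⟨f t, t.2⟩)⁻¹ * t.1.1.2, hZ (hφ t)⟩
      map_one' := by
        apply Subtype.ext
        have : (⟨f ((1 : T) : D), (1 : T).2⟩ : P) = 1 := Subtype.ext (by simp)
        change (π ⟨f ((1 : T) : D), (1 : T).2⟩)⁻¹ * 1 = 1
        rw [this]; simp
      map_mul' := by
        intro s t
        apply Subtype.ext
        have : (⟨f ((s * t : T) : D), (s * t).2⟩ : P) = ⟨f s, s.2⟩ * ⟨f t, t.2⟩ :=
          Subtype.ext (by simp)
        have hcen := Subgroup.mem_center_iff.1 (hZ (hφ s)) ((π ⟨f t, t.2⟩)⁻¹)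
        change (π ⟨f ((s * t : T) : D), (s * t).2⟩)⁻¹ * (s.1.1.2 * t.1.1.2) =
          (π ⟨f s, s.2⟩)⁻¹ * s.1.1.2 * ((π ⟨f t, t.2⟩)⁻¹ * t.1.1.2)
        rw [this, map_mul, mul_inv_rev, ← mul_assoc _ _ t.1.1.2, ← mul_assoc _ _ t.1.1.2, ← hcen]
        simp only [mul_assoc] }
  let τ : D →* Subgroup.center U := MonoidHom.transfer φ
  have hA : IsPGroup p (Subgroup.center U) := hU.to_subgroup _
  -- trivial on K
  let i : κ.ker →* D :=
    { toFun := fun k => ⟨(k, 1), (hD _ _).2 (by rw [map_one]; exact k.2)⟩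
      map_one' := rfl
      map_mul' := fun a b => Subtype.ext (by simp) }
  have htriv : ∀ k : κ.ker, τ (i k) = 1 := by
    have : κ.ker ≤ ((τ.comp i).ker).map κ.ker.subtype := by
      refine hK.trans ((Subgroup.closure_le _).2 ?_)
      rintro k ⟨hk, hkp⟩
      refine ⟨⟨k, hk⟩, ?_, rfl⟩
      by_contra hne
      have h1 := hA.dvd_orderOf (g := (τ.comp i) ⟨k, hk⟩) hne
      refine hkp (h1.trans ((orderOf_map_dvd _ _).trans ?_))
      rw [Subgroup.orderOf_mk]
    intro k
    obtain ⟨k', hk', h⟩ := this k.2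
    have : k' = k := Subtype.ext h
    rw [← this]; exact hk'
  let j : P →* D :=
    { toFun := fun y => ⟨(y, π y), (hD _ _).2 (hc y).symm⟩
      map_one' := Subtype.ext (by simp)
      map_mul' := fun a b => Subtype.ext (by simp) }
  have hj : τ (j r) = 1 := by
    have := Abelianization.commutator_subset_ker (τ.comp j) hr'
    exact this
  have hπr : π r ∈ ψ.ker := by rw [MonoidHom.mem_ker, hc]; exact hr
  have hπc := Subgroup.mem_center_iff.1 (hZ hπr)
  let z : D := ⟨(1, π r), (hD _ _).2 (by rw [map_one]; exact hπr.symm)⟩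
  have hjz : j r = i ⟨r, hr⟩ * z := Subtype.ext (by simp [i, j, z])
  have hz : τ z = 1 := by rw [hjz, map_mul, htriv, one_mul] at hj; exact hj
  have hzc : ∀ d : D, Commute d z := by
    rintro ⟨⟨g, u⟩, hd⟩
    apply Subtype.ext
    simp [z, hπc u]
  have hkey := MonoidHom.transfer_eq_pow φ z (fun k g₀ _ => by
    rw [mul_assoc, ← ((hzc g₀).pow_right k).eq, inv_mul_cancel_left])
  change τ z = _ at hkey
  rw [hz] at hkey
  have h3 := congrArg Subtype.val hkey
  have h4 : π r ^ T.index = 1 := by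
    have h5 : ∀ (n : ℕ) (hn : z ^ n ∈ T), ((φ ⟨z ^ n, hn⟩ : Subgroup.center U) : U) = π r ^ n := by
      intro n hn
      have : (⟨f (z ^ n), hn⟩ : P) = 1 := Subtype.ext (by simp [f, z])
      change (π ⟨f (z ^ n), hn⟩)⁻¹ * (z ^ n).1.2 = _
      rw [this]; simp [z]
    rw [h5] at h3
    exact h3.symm
  by_contra hne
  have := hU.dvd_orderOf hne
  exact hp.one_lt.ne' (Nat.eq_one_of_dvd_coprimes hTi (this.trans (orderOf_dvd_of_pow_eq_one h4)) dvd_rfl)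

theorem tate {G : Type*} [Group G] [Finite G] {p : ℕ} [Fact p.Prime] (P : Sylow p G)
    (N : Subgroup G) [N.Normal] (hPN : ∀ r : P, (r : G) ∈ N → r ∈ commutator P) :
    ∃ K : Subgroup G, K.Normal ∧ K ≤ N ∧ ¬ p ∣ Nat.card K ∧ ∀ n ∈ N, ∃ k : ℕ, n ^ p ^ k ∈ K := by
  have hp : p.Prime := Fact.out
  let K : Subgroup G := Subgroup.closure {k | k ∈ N ∧ ¬ p ∣ orderOf k}
  have hKn : K.Normal := by
    refine ⟨fun k hk g => ?_⟩
    have : K ≤ K.comap (MulAut.conj g).toMonoidHom := by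
      refine (Subgroup.closure_le _).2 ?_
      rintro k ⟨h1, h2⟩
      refine Subgroup.subset_closure ⟨Subgroup.Normal.conj_mem inferInstance k h1 g, ?_⟩
      have := (MulAut.conj g).orderOf_eq k
      change ¬ p ∣ orderOf (MulAut.conj g k)
      rwa [this]
    exact this hk
  have hKN : K ≤ N := (Subgroup.closure_le _).2 fun k hk => hk.1
  refine ⟨K, hKn, hKN, ?_, ?_⟩
  · let R : Subgroup P := K.subgroupOf P
    let S : Subgroup P := ⁅R, ⊤⁆
    have hSR : S ≤ R := Subgroup.commutator_le_left _ _
    let κ := QuotientGroup.mk' K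
    let ψ : P ⧸ S →* G ⧸ K := QuotientGroup.lift S (κ.comp (P : Subgroup G).subtype) (by
      intro s hs
      exact (QuotientGroup.eq_one_iff _).2 (hSR hs))
    have hker : κ.ker = K := QuotientGroup.ker_mk' K
    have h1 := tate_aux (p := p) (P : Subgroup G) P.not_dvd_index
      (P.isPGroup'.to_quotient S) (QuotientGroup.mk' S) ψ κ (fun y => rfl)
      (by
        intro u hu
        obtain ⟨y, rfl⟩ := QuotientGroup.mk'_surjective S u
        have hy : y ∈ R := (QuotientGroup.eq_one_iff (y : G)).1 hu
        rw [Subgroup.mem_center_iff]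
        intro v
        obtain ⟨w, rfl⟩ := QuotientGroup.mk'_surjective S v
        rw [← map_mul, ← map_mul]
        apply Eq.symm
        rw [← mul_inv_eq_one, ← map_inv, ← map_mul]
        refine (QuotientGroup.eq_one_iff _).2 ?_
        have := Subgroup.commutator_mem_commutator hy (Subgroup.mem_top w)
        simpa [commutatorElement_def, mul_assoc] using this)
      (by
        rw [hker]
        refine (Subgroup.closure_le _).2 fun k hk => Subgroup.subset_closure
          ⟨Subgroup.subset_closure hk, hk.2⟩)
    have hRS : R ≤ S := fun r hr => by
      have := h1 r (by rw [hker]; exact hr) (hPN r (hKN hr))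
      exact (QuotientGroup.eq_one_iff _).1 this
    have hnil : Group.IsNilpotent P := P.isPGroup'.isNilpotent
    have hlow : ∀ n, R ≤ (⊤ : Subgroup P).lowerCentralSeries n := by
      intro n
      induction n with
      | zero => simp
      | succ n ih => exact hRS.trans (Subgroup.commutator_mono ih le_rfl)
    obtain ⟨n, hn⟩ := Subgroup.nilpotent_iff_lowerCentralSeries.1 hnil
    have hbot : R = ⊥ := by rw [eq_bot_iff, ← hn]; exact hlow n
    intro hd
    obtain ⟨k, hk⟩ := exists_prime_orderOf_dvd_card' p hd
    have hzp : IsPGroup p (Subgroup.zpowers (k : G)) := by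
      apply IsPGroup.of_card (n := 1)
      rw [Nat.card_zpowers, Subgroup.orderOf_coe, hk, pow_one]
    obtain ⟨Q, hQ⟩ := hzp.exists_le_sylow
    obtain ⟨g, hg⟩ := MulAction.exists_smul_eq G P Q
    have hkQ : (k : G) ∈ (Q : Subgroup G) := hQ (Subgroup.mem_zpowers _)
    rw [← hg, Sylow.coe_subgroup_smul, Subgroup.mem_pointwise_smul_iff_inv_smul_mem] at hkQ
    have hkQ' : g⁻¹ * (k : G) * g ∈ (P : Subgroup G) := by simpa [← map_inv, MulAut.smul_def] using hkQ
    have hkK : g⁻¹ * (k : G) * g ∈ K := by simpa using hKn.conj_mem k k.2 g⁻¹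
    have : (⟨_, hkQ'⟩ : P) ∈ R := hkK
    rw [hbot, Subgroup.mem_bot] at this
    have h2 : g⁻¹ * (k : G) * g = 1 := congrArg Subtype.val this
    have h3 : (k : G) = 1 := by
      have : (k : G) = g * (g⁻¹ * (k : G) * g) * g⁻¹ := by group
      rw [this, h2]; simp
    have h4 : k = 1 := Subtype.ext h3
    rw [h4, orderOf_one] at hk
    exact hp.one_lt.ne hk
  · intro n hn
    have h0 : orderOf n ≠ 0 := (orderOf_pos n).ne'
    refine ⟨(orderOf n).factorization p, Subgroup.subset_closure ⟨N.pow_mem hn _, ?_⟩⟩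
    rw [orderOf_pow_of_dvd (pow_ne_zero _ hp.ne_zero) (Nat.ordProj_dvd _ _)]
    exact Nat.not_dvd_ordCompl hp h0

theorem index_centralizer_comap {L G : Type*} [Group L] [Group G] (f : L →* G) (x : G) :
    ((Subgroup.centralizer {x}).comap f).index = (Set.range fun y => f y * x * (f y)⁻¹).ncard := by
  let _ : MulAction L G := MulAction.compHom G ((MulAut.conj (G := G)).comp f)
  have hs : ∀ (y : L) (g : G), y • g = f y * g * (f y)⁻¹ := fun y g => rfl
  have h := MulAction.index_stabilizer L x
  have h1 : MulAction.stabilizer L x = (Subgroup.centralizer {x}).comap f := by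
    ext y
    rw [MulAction.mem_stabilizer_iff, hs, Subgroup.mem_comap, Subgroup.mem_centralizer_singleton_iff,
      mul_inv_eq_iff_eq_mul]
  rw [← h1, h]
  rfl

open scoped commutatorElement in
theorem exists_sylow {G : Type*} [Group G] [Finite G] {p : ℕ} [Fact p.Prime]
    (N : Subgroup G) [N.Normal] (x : G) (hx : ∃ k : ℕ, orderOf x = p ^ k)
    (h1 : ∀ n ∈ N, ∃ g : G, g * x * g⁻¹ = x * n) (h2 : ∀ g : G, x⁻¹ * (g * x * g⁻¹) ∈ N) :
    ∃ P : Sylow p G, ∀ r : P, (r : G) ∈ N → r ∈ commutator P := by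
  have hp : p.Prime := Fact.out
  let C := Subgroup.centralizer {x}
  have hxC : x ∈ C := Subgroup.mem_centralizer_singleton_iff.2 rfl
  have hzp : IsPGroup p (Subgroup.zpowers (⟨x, hxC⟩ : C)) := by
    obtain ⟨k, hk⟩ := hx
    apply IsPGroup.of_card (n := k)
    rw [Nat.card_zpowers, Subgroup.orderOf_mk, hk]
  obtain ⟨S, hS⟩ := hzp.exists_le_sylow
  obtain ⟨P, hP⟩ := Sylow.exists_comap_subtype_eq S
  have hxP : x ∈ (P : Subgroup G) := by
    have : (⟨x, hxC⟩ : C) ∈ (S : Subgroup C) := hS (Subgroup.mem_zpowers _)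
    rw [← hP] at this
    exact this
  refine ⟨P, ?_⟩
  -- counting
  have hCN : C.index = Nat.card N := by
    have := index_centralizer_comap (MonoidHom.id G) x
    rw [Subgroup.comap_id] at this
    rw [this, ← Nat.card_coe_set_eq]
    refine Nat.card_congr ((Equiv.subtypeEquiv (Equiv.mulLeft x⁻¹) ?_))
    intro a
    constructor
    · rintro ⟨g, rfl⟩
      exact h2 g
    · intro ha
      obtain ⟨g, hg⟩ := h1 _ ha
      exact ⟨g, by simpa using hg⟩
  let O : Set G := Set.range fun y : P => (y : G) * x * (y : G)⁻¹
  have hO : C.relIndex P = O.ncard := index_centralizer_comap (P : Subgroup G).subtype x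
  let Q : Subgroup G := N ⊓ P
  have hQp : IsPGroup p Q := P.isPGroup'.to_inf_right
  have e1 : Nat.card P * (P : Subgroup G).index = Nat.card G := Subgroup.card_mul_index _
  have e2 : Nat.card C * C.index = Nat.card G := Subgroup.card_mul_index _
  have e3 : Nat.card S * (S : Subgroup C).index = Nat.card C := Subgroup.card_mul_index _
  have e4 : Nat.card S * C.relIndex P = Nat.card P := by
    have h3 : Nat.card S = Nat.card (C.subgroupOf P) := by
      change Nat.card (S : Subgroup C) = _
      rw [← hP]
      change Nat.card ((P : Subgroup G).subgroupOf C) = _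
      exact Nat.card_congr ⟨fun a => ⟨⟨a.1.1, a.2⟩, a.1.2⟩, fun a => ⟨⟨a.1.1, a.2⟩, a.1.2⟩,
        fun _ => rfl, fun _ => rfl⟩
    rw [h3]; exact Subgroup.card_mul_index _
  have e5 : C.relIndex P * (P : Subgroup G).index = (S : Subgroup C).index * Nat.card N := by
    have : 0 < Nat.card S := Nat.card_pos
    apply Nat.eq_of_mul_eq_mul_left this
    rw [← mul_assoc, e4, e1, ← mul_assoc, e3, ← hCN, e2]
  have e6 : Nat.card Q ∣ C.relIndex P := by
    have h3 : Nat.card Q ∣ C.relIndex P * (P : Subgroup G).index := by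
      rw [e5]
      exact (Subgroup.card_dvd_of_le inf_le_left).mul_left _
    refine Nat.Coprime.dvd_of_dvd_mul_right ?_ h3
    obtain ⟨n, hn⟩ := IsPGroup.iff_card.1 hQp
    rw [hn]
    exact Nat.Coprime.pow_left _ (hp.coprime_iff_not_dvd.2 P.not_dvd_index)
  have e7 : Nat.card Q ≤ O.ncard := by
    rw [← hO]
    refine Nat.le_of_dvd (Nat.pos_of_ne_zero ?_) e6
    rw [hO]
    exact Set.ncard_ne_zero_of_mem (a := x) ⟨1, by simp⟩
  have e8 : O = (fun q => x * q) '' (Q : Set G) := by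
    apply Set.eq_of_subset_of_ncard_le
    · rintro _ ⟨y, rfl⟩
      refine ⟨x⁻¹ * (y * x * (y : G)⁻¹), ⟨h2 y, ?_⟩, by group⟩
      have hyP : (y : G) ∈ (P : Subgroup G) := y.2
      exact (P : Subgroup G).mul_mem ((P : Subgroup G).inv_mem hxP)
        ((P : Subgroup G).mul_mem ((P : Subgroup G).mul_mem hyP hxP) ((P : Subgroup G).inv_mem hyP))
    · rw [Set.ncard_image_of_injective _ (mul_right_injective x)]
      exact e7
    · exact Set.toFinite _
  intro r hr
  have hm : x * r ∈ O := by rw [e8]; exact ⟨r, ⟨hr, r.2⟩, rfl⟩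
  obtain ⟨y, hy⟩ := hm
  let y' : (P : Subgroup G) := y
  have hyy : (y' : G) = (y : G) := rfl
  have : r = ⁅(⟨x, hxP⟩ : (P : Subgroup G))⁻¹, y'⁆ := by
    apply Subtype.ext
    have hy' : (y' : G) * x * (y' : G)⁻¹ = x * r := hy
    rw [commutatorElement_def]
    simp only [Subgroup.coe_mul, Subgroup.coe_inv, inv_inv, mul_assoc] at hy' ⊢
    rw [hy']; simp
  rw [this]
  exact Subgroup.commutator_mem_commutator (Subgroup.mem_top _) (Subgroup.mem_top _)

theorem stmt9 {G : Type*} [Group G] [Fintype G] (N : Subgroup G) [N.Normal]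
    (p : ℕ) (hp : p.Prime) (x : G) (hx : ∃ k : ℕ, orderOf x = p ^ k)
    (h : ∀ a ∈ x • (N : Set G), ∀ b ∈ x • (N : Set G), IsConj a b) :
    ∃ H : Subgroup N, ∃ hn : H.Normal, (Nat.card H).Coprime p ∧
      (letI := hn; IsPGroup p (N ⧸ H)) := by
  have : Fact p.Prime := ⟨hp⟩
  -- the preimage of the centralizer of `xN` in `G ⧸ N`
  let L : Subgroup G := (Subgroup.centralizer {(x : G ⧸ N)}).comap (QuotientGroup.mk' N)
  have hL : ∀ g, g ∈ L ↔ x⁻¹ * (g * x * g⁻¹) ∈ N := by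
    intro g
    rw [Subgroup.mem_comap, Subgroup.mem_centralizer_singleton_iff, ← QuotientGroup.eq]
    simp only [QuotientGroup.mk'_apply, QuotientGroup.mk_mul, QuotientGroup.mk_inv]
    rw [eq_mul_inv_iff_mul_eq, eq_comm]
  have hNL : N ≤ L := by
    intro n hn
    rw [hL]
    have := Subgroup.Normal.conj_mem (H := N) inferInstance n hn x⁻¹
    have h2 := mul_mem this (inv_mem hn)
    simpa [mul_assoc] using h2
  have hxL : x ∈ L := by rw [hL]; simp
  obtain ⟨P, hP⟩ := exists_sylow (p := p) (N.subgroupOf L) (⟨x, hxL⟩ : L)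
    (by simpa [Subgroup.orderOf_mk] using hx)
    (by
      intro n hn
      have hn' : (n : G) ∈ N := hn
      have := h x ⟨1, N.one_mem, by simp⟩ (x * n) ⟨n, hn', rfl⟩
      obtain ⟨g, hg⟩ := isConj_iff.1 this
      have hgL : g ∈ L := by rw [hL, hg]; simpa using hn'
      exact ⟨⟨g, hgL⟩, Subtype.ext hg⟩)
    (fun g => (hL g).1 g.2)
  obtain ⟨K, hKn, hKN, hKp, hK⟩ := tate P (N.subgroupOf L) hP
  let i : N →* L := Subgroup.inclusion hNL
  have hi : Function.Injective i := Subgroup.inclusion_injective hNL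
  have hn : (K.comap i).Normal := hKn.comap i
  refine ⟨K.comap i, hn, ?_, ?_⟩
  · rw [Nat.coprime_comm, hp.coprime_iff_not_dvd]
    intro hd
    refine hKp (hd.trans ?_)
    exact Subgroup.card_comap_dvd_of_injective K i hi
  · rw [isPGroup_iff_pow_pow_eq_one]
    intro u
    obtain ⟨n, rfl⟩ := QuotientGroup.mk_surjective u
    obtain ⟨k, hk⟩ := hK (i n) n.2
    refine ⟨k, ?_⟩
    rw [← QuotientGroup.mk_pow, QuotientGroup.eq_one_iff, Subgroup.mem_comap, map_pow]
    exact hk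
end
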